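/- Let A be the symmetric adjacency matrix of the multigraph obtained from the 4442 base graph by adding one new vertex w joined to u₂ by a double edge (so the (w,u₂) and (u₂,w) entries of A equal 2). Then A has an eigenvalue strictly larger than √(3+√5): there exist a real number μ > √(3+√5) and a nonzero real vector v with A·v = μ·v. -/

import Mathlib

open Matrix

/-- 4442 base graph (path 0-1-2-3-4 with 5,6,7 adjacent to 4); vertex 8 is joined to 6 by a double edge. -/
def edgesDouble4442 : List (Fin 9 × Fin 9) :=
  [(0,1),(1,2),(2,3),(3,4),(4,5),(4,6),(4,7)]

/-- Adjacency matrix of the multigraph: entry is the number of edges between the vertices;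
the pair (6, 8) is joined by a double edge. -/
def adjDouble4442 : Matrix (Fin 9) (Fin 9) ℝ :=
  fun i j =>
    if (i, j) ∈ edgesDouble4442 ∨ (j, i) ∈ edgesDouble4442 then 1
    else if (i, j) = (6, 8) ∨ (i, j) = (8, 6) then 2
    else 0

theorem adjDouble4442_eq : adjDouble4442 =
    !![0, 1, 0, 0, 0, 0, 0, 0, 0;
       1, 0, 1, 0, 0, 0, 0, 0, 0;
       0, 1, 0, 1, 0, 0, 0, 0, 0;
       0, 0, 1, 0, 1, 0, 0, 0, 0;
       0, 0, 0, 1, 0, 1, 1, 1, 0;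
       0, 0, 0, 0, 1, 0, 0, 0, 0;
       0, 0, 0, 0, 1, 0, 0, 0, 2;
       0, 0, 0, 0, 1, 0, 0, 0, 0;
       0, 0, 0, 0, 0, 0, 2, 0, 0] := by
  ext i j
  fin_cases i <;> fin_cases j <;> simp [adjDouble4442, edgesDouble4442]

/-- A root `x` of this polynomial is an eigenvalue of `adjDouble4442`: it is the condition left at the
quadruple point after solving the eigenvector equations along the four branches. -/
theorem adjDouble4442_mulVec_eq_smul {x : ℝ}
    (hx : (x ^ 4 - 3 * x ^ 2 + 1) * (x ^ 4 - 7 * x ^ 2 + 8)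
      - x ^ 2 * (x ^ 2 - 4) * (x ^ 2 - 2) = 0) :
    let c := x * (x ^ 2 - 4)
    let p := x ^ 4 - 3 * x ^ 2 + 1
    let v : Fin 9 → ℝ := ![c, c * x, c * (x ^ 2 - 1), c * (x ^ 3 - 2 * x), c * p,
      (x ^ 2 - 4) * p, x ^ 2 * p, (x ^ 2 - 4) * p, 2 * x * p]
    adjDouble4442.mulVec v = x • v := by
  intro c p v
  funext i
  fin_cases i <;>
    simp [v, c, p, adjDouble4442_eq, Matrix.mulVec, dotProduct, Fin.sum_univ_succ] <;>
    linarith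

theorem exists_root_between :
    ∃ x : ℝ, 12 / 5 ≤ x ∧ (x ^ 4 - 3 * x ^ 2 + 1) * (x ^ 4 - 7 * x ^ 2 + 8)
      - x ^ 2 * (x ^ 2 - 4) * (x ^ 2 - 2) = 0 := by
  obtain ⟨x, hx, h⟩ := intermediate_value_Icc (a := (12 / 5 : ℝ)) (b := 5 / 2) (by norm_num)
    (f := fun x ↦ (x ^ 4 - 3 * x ^ 2 + 1) * (x ^ 4 - 7 * x ^ 2 + 8)
      - x ^ 2 * (x ^ 2 - 4) * (x ^ 2 - 2)) (by fun_prop)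
    (show (0 : ℝ) ∈ _ by constructor <;> norm_num)
  exact ⟨x, hx.1, h⟩

theorem sqrt_three_add_sqrt_five_lt : Real.sqrt (3 + Real.sqrt 5) < 12 / 5 := by
  have h : Real.sqrt 5 < 23 / 10 := by
    rw [Real.sqrt_lt' (by norm_num)]
    norm_num
  rw [Real.sqrt_lt' (by norm_num)]
  linarith

theorem thmDouble4442 :
    ∃ μ : ℝ, μ > Real.sqrt (3 + Real.sqrt 5) ∧
      ∃ v : Fin 9 → ℝ, v ≠ 0 ∧ (adjDouble4442).mulVec v = μ • v := by
  obtain ⟨x, hle, hx⟩ := exists_root_between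
  refine ⟨x, sqrt_three_add_sqrt_five_lt.trans_le hle, _, fun hv ↦ ?_,
    adjDouble4442_mulVec_eq_smul hx⟩
  have h₀ : x * (x ^ 2 - 4) = 0 := congrFun hv 0
  have hpos : 0 < x * (x ^ 2 - 4) := mul_pos (by linarith) (by nlinarith)
  exact hpos.ne' h₀
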